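/- Let m ≥ 2, α⃗ ∈ {0,1}^m with σ(α⃗) > 1, and 1 < p₁,…,p_m < ∞, and define r by 1/r = Σ_{j=1}^m 1/p_j, and let b be locally integrable. If there is a constant C such that ‖π_b^{α⃗}(f₁,…,f_m)‖_{L^r} ≤ C ∏_{j=1}^m ‖f_j‖_{L^{p_j}} for all bounded compactly supported f₁,…,f_m, then sup_{J∈𝒟} |⟨b, h_J⟩|/√|J| ≤ C. -/

import Mathlib

open MeasureTheory Filter Topology
open scoped ENNReal NNReal Classical

noncomputable section

/-- The dyadic interval `[n·2⁻ᵏ, (n+1)·2⁻ᵏ)`. -/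
def dyadicI (n k : ℤ) : Set ℝ :=
  Set.Ico ((n : ℝ) * (2 : ℝ) ^ (-k)) (((n : ℝ) + 1) * (2 : ℝ) ^ (-k))

/-- The Haar function `h_I = |I|^{-1/2} (1_{I₊} - 1_{I₋})` of the dyadic interval
`I = [n·2⁻ᵏ, (n+1)·2⁻ᵏ)`, whose halves are the dyadic intervals indexed by
`(2n, k+1)` and `(2n+1, k+1)`. -/
def haarF (n k : ℤ) : ℝ → ℝ := fun x =>
  (Real.sqrt ((2 : ℝ) ^ (-k)))⁻¹ *
    ((dyadicI (2 * n + 1) (k + 1)).indicator (fun _ => (1 : ℝ)) x -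
      (dyadicI (2 * n) (k + 1)).indicator (fun _ => (1 : ℝ)) x)

/-- `⟨f, h_I⟩ = ∫ f h_I`. -/
def pairH (f : ℝ → ℝ) (n k : ℤ) : ℝ := ∫ x, f x * haarF n k x

/-- `⟨f⟩_I = |I|⁻¹ ∫_I f`. -/
def avgI (f : ℝ → ℝ) (n k : ℤ) : ℝ := (2 : ℝ) ^ k * ∫ x in dyadicI n k, f x

/-- `f(I, α)` for `α ∈ {0,1}`, where `false` is `0` (Haar coefficient)
and `true` is `1` (average). -/
def coefI (f : ℝ → ℝ) (a : Bool) (n k : ℤ) : ℝ := if a then avgI f n k else pairH f n k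

/-- `σ(α⃗)`, the number of `0` components of `α⃗ ∈ {0,1}^m`. -/
def sigmaV {m : ℕ} (α : Fin m → Bool) : ℕ := (Finset.univ.filter fun j => α j = false).card

/-- The term `P_I^{α⃗}(f₁,…,f_m)(x) = (∏ f_j(I,α_j)) h_I^{σ(α⃗)}(x)` for `I = (n,k)`. -/
def Pterm {m : ℕ} (α : Fin m → Bool) (f : Fin m → ℝ → ℝ) (n k : ℤ) (x : ℝ) : ℝ :=
  (∏ j, coefI (f j) (α j) n k) * haarF n k x ^ sigmaV α

/-- The term of the paraproduct `π_b^{α⃗}`: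
`⟨b, h_I⟩ (∏ f_j(I,α_j)) h_I^{1+σ(α⃗)}(x)` for `I = (n,k)`. -/
def piTerm {m : ℕ} (b : ℝ → ℝ) (α : Fin m → Bool) (f : Fin m → ℝ → ℝ) (n k : ℤ) (x : ℝ) : ℝ :=
  pairH b n k * (∏ j, coefI (f j) (α j) n k) * haarF n k x ^ (1 + sigmaV α)

/-- The term of the `m`-linear Haar multiplier `T_ε^{α⃗}`:
`ε_I (∏ f_j(I,α_j)) h_I^{σ(α⃗)}(x)` for `I = (n,k)`. -/
def Tterm {m : ℕ} (ε : ℤ → ℤ → ℝ) (α : Fin m → Bool) (f : Fin m → ℝ → ℝ) (n k : ℤ) (x : ℝ) : ℝ :=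
  ε n k * (∏ j, coefI (f j) (α j) n k) * haarF n k x ^ sigmaV α

/-- Partial sum of a series indexed by the dyadic grid: all scales `k` with `|k| ≤ N`
(at each scale the sum over positions is a `tsum`). -/
def dyadicPartialSum (F : ℤ → ℤ → ℝ → ℝ) (N : ℕ) (x : ℝ) : ℝ :=
  ∑ k ∈ Finset.Icc (-(N : ℤ)) (N : ℤ), ∑' n : ℤ, F n k x

/-- `g` is the a.e.-pointwise sum of the series `Σ_{I ∈ 𝒟} F_I`. -/
def HasDyadicSum (F : ℤ → ℤ → ℝ → ℝ) (g : ℝ → ℝ) : Prop :=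
  ∀ᵐ x : ℝ ∂volume, Tendsto (fun N => dyadicPartialSum F N x) atTop (𝓝 (g x))

/-- The dyadic BMO norm `sup_{I∈𝒟} |I|⁻¹ ∫_I |b - ⟨b⟩_I|`. -/
def bmoNorm (b : ℝ → ℝ) : ℝ≥0∞ :=
  ⨆ (n : ℤ) (k : ℤ),
    ENNReal.ofReal ((2 : ℝ) ^ k) * ∫⁻ x in dyadicI n k, ENNReal.ofReal |b x - avgI b n k|

/-- The weak `L^r` quasinorm `sup_{t>0} t |{|f| > t}|^{1/r}`. -/
def wnorm' (r : ℝ) (f : ℝ → ℝ) : ℝ≥0∞ :=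
  ⨆ t : ℝ≥0, (t : ℝ≥0∞) * volume {x : ℝ | (t : ℝ) < |f x|} ^ (1 / r)

/-- `sup_{I∈𝒟} |⟨b,h_I⟩| / √|I|`. -/
def starNorm (b : ℝ → ℝ) : ℝ≥0∞ :=
  ⨆ (n : ℤ) (k : ℤ), ENNReal.ofReal (|pairH b n k| / Real.sqrt ((2 : ℝ) ^ (-k)))

/-- Bounded, compactly supported, measurable function. -/
def BCS (f : ℝ → ℝ) : Prop :=
  Measurable f ∧ (∃ M : ℝ, ∀ x, |f x| ≤ M) ∧ HasCompactSupport f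

/-- `‖ε‖_∞ = sup_{I∈𝒟} |ε_I|` for a symbol sequence indexed by the dyadic grid. -/
def epsNorm (ε : ℤ → ℤ → ℝ) : ℝ≥0∞ := ⨆ (n : ℤ) (k : ℤ), ENNReal.ofReal |ε n k|

theorem mem_dyadicI_iff (n k : ℤ) (x : ℝ) : x ∈ dyadicI n k ↔ ⌊x * (2 : ℝ) ^ k⌋ = n := by
  have h : (0 : ℝ) < 2 ^ k := by positivity
  rw [Int.floor_eq_iff, dyadicI, Set.mem_Ico, zpow_neg, ← div_eq_mul_inv, ← div_eq_mul_inv,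
    div_le_iff₀ h, lt_div_iff₀ h]

/-- The index of the dyadic interval of scale `k` containing `x` is determined by the index
at any finer scale. -/
theorem floor_mul_zpow_eq_div (x : ℝ) (k : ℤ) (d : ℕ) :
    ⌊x * (2 : ℝ) ^ k⌋ = ⌊x * (2 : ℝ) ^ (k + d)⌋ / (2 ^ d : ℕ) := by
  rw [← Int.floor_div_natCast]
  congr 1
  rw [zpow_add₀ (by norm_num)]
  push_cast
  rw [zpow_natCast]
  field_simp

theorem floor_mul_zpow_eq_div_two (x : ℝ) (k : ℤ) :
    ⌊x * (2 : ℝ) ^ k⌋ = ⌊x * (2 : ℝ) ^ (k + 1)⌋ / 2 := by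
  simpa using floor_mul_zpow_eq_div x k 1

theorem measurableSet_dyadicI (n k : ℤ) : MeasurableSet (dyadicI n k) := measurableSet_Ico

theorem volume_dyadicI (n k : ℤ) : volume (dyadicI n k) = ENNReal.ofReal ((2 : ℝ) ^ (-k)) := by
  rw [dyadicI, Real.volume_Ico]
  congr 1
  ring

theorem volume_dyadicI_pos (n k : ℤ) : 0 < volume (dyadicI n k) := by
  rw [volume_dyadicI, ENNReal.ofReal_pos]
  positivity

theorem volume_dyadicI_ne_top (n k : ℤ) : volume (dyadicI n k) ≠ ⊤ := by
  rw [volume_dyadicI]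
  exact ENNReal.ofReal_ne_top

theorem volume_real_dyadicI (n k : ℤ) : volume.real (dyadicI n k) = (2 : ℝ) ^ (-k) := by
  rw [measureReal_def, volume_dyadicI, ENNReal.toReal_ofReal (by positivity)]

theorem integrable_indicator_dyadicI (n k : ℤ) (c : ℝ) :
    Integrable ((dyadicI n k).indicator fun _ => c) volume :=
  (integrable_indicator_iff (measurableSet_dyadicI n k)).2
    (integrableOn_const (volume_dyadicI_ne_top n k))

theorem abs_haarF (n k : ℤ) (x : ℝ) :
    |haarF n k x| = (dyadicI n k).indicator (fun _ => (Real.sqrt ((2 : ℝ) ^ (-k)))⁻¹) x := by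
  have h := floor_mul_zpow_eq_div_two x k
  have hs : 0 ≤ (Real.sqrt ((2 : ℝ) ^ (-k)))⁻¹ := by positivity
  simp only [haarF, Set.indicator_apply, mem_dyadicI_iff]
  by_cases h1 : ⌊x * (2 : ℝ) ^ (k + 1)⌋ = 2 * n + 1
  · rw [if_pos h1, if_neg (by omega), if_pos (by omega)]
    simp
  · by_cases h2 : ⌊x * (2 : ℝ) ^ (k + 1)⌋ = 2 * n
    · rw [if_neg h1, if_pos h2, if_pos (by omega)]
      simp
    · rw [if_neg h1, if_neg h2, if_neg (by omega)]
      simp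

theorem haarF_eq_zero_of_notMem {n k : ℤ} {x : ℝ} (hx : x ∉ dyadicI n k) : haarF n k x = 0 := by
  rw [← abs_eq_zero, abs_haarF, Set.indicator_of_notMem hx]

theorem integral_haarF (n k : ℤ) : ∫ x, haarF n k x = 0 := by
  simp only [haarF]
  rw [integral_const_mul, integral_sub (integrable_indicator_dyadicI _ _ _)
    (integrable_indicator_dyadicI _ _ _), integral_indicator_const _ (measurableSet_dyadicI _ _),
    integral_indicator_const _ (measurableSet_dyadicI _ _), volume_real_dyadicI,
    volume_real_dyadicI]
  simp

theorem haarF_mul_self (n k : ℤ) (x : ℝ) :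
    haarF n k x * haarF n k x = (dyadicI n k).indicator (fun _ => ((2 : ℝ) ^ (-k))⁻¹) x := by
  rw [← abs_mul_abs_self, abs_haarF]
  by_cases hx : x ∈ dyadicI n k
  · rw [Set.indicator_of_mem hx, Set.indicator_of_mem hx, ← mul_inv,
      Real.mul_self_sqrt (by positivity)]
  · simp [hx]

theorem pairH_haarF_self (n k : ℤ) : pairH (haarF n k) n k = 1 := by
  simp only [pairH, haarF_mul_self]
  rw [integral_indicator_const _ (measurableSet_dyadicI _ _), volume_real_dyadicI, smul_eq_mul]
  exact mul_inv_cancel₀ (by positivity)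

/-- A Haar function is constant on every dyadic interval of finer scale. -/
theorem haarF_eq_of_mem_dyadicI {n k n' k' : ℤ} (hk : k < k') {x y : ℝ}
    (hx : x ∈ dyadicI n' k') (hy : y ∈ dyadicI n' k') : haarF n k x = haarF n k y := by
  obtain ⟨d, rfl⟩ : ∃ d : ℕ, k' = k + 1 + d := ⟨(k' - (k + 1)).toNat, by omega⟩
  rw [mem_dyadicI_iff] at hx hy
  simp only [haarF, Set.indicator_apply, mem_dyadicI_iff, floor_mul_zpow_eq_div _ (k + 1) d, hx, hy]

theorem pairH_comm (n k n' k' : ℤ) : pairH (haarF n k) n' k' = pairH (haarF n' k') n k := by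
  simp only [pairH, mul_comm]

theorem pairH_haarF_of_lt (n n' : ℤ) {k k' : ℤ} (hk : k < k') :
    pairH (haarF n k) n' k' = 0 := by
  have hmem : (n' : ℝ) * (2 : ℝ) ^ (-k') ∈ dyadicI n' k' := by
    have : (0 : ℝ) < 2 ^ (-k') := by positivity
    exact ⟨le_rfl, by linarith⟩
  have h : ∀ x, haarF n k x * haarF n' k' x =
      haarF n k ((n' : ℝ) * (2 : ℝ) ^ (-k')) * haarF n' k' x := by
    intro x
    by_cases hx : x ∈ dyadicI n' k'
    · rw [haarF_eq_of_mem_dyadicI hk hx hmem]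
    · rw [haarF_eq_zero_of_notMem hx, mul_zero, mul_zero]
  simp only [pairH, h]
  rw [integral_const_mul, integral_haarF, mul_zero]

theorem pairH_haarF_of_ne {n k n' k' : ℤ} (h : ¬(n' = n ∧ k' = k)) :
    pairH (haarF n k) n' k' = 0 := by
  rcases lt_trichotomy k k' with hk | rfl | hk
  · exact pairH_haarF_of_lt _ _ hk
  · have hz : ∀ x, haarF n k x * haarF n' k x = 0 := by
      intro x
      by_cases hx : x ∈ dyadicI n k
      · have hx' : x ∉ dyadicI n' k := by
          rw [mem_dyadicI_iff] at hx ⊢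
          exact fun h' => h ⟨h'.symm.trans hx, rfl⟩
        rw [haarF_eq_zero_of_notMem hx', mul_zero]
      · rw [haarF_eq_zero_of_notMem hx, zero_mul]
    simp [pairH, hz]
  · rw [pairH_comm]
    exact pairH_haarF_of_lt _ _ hk

theorem avgI_indicator_self (n k : ℤ) :
    avgI ((dyadicI n k).indicator fun _ => (1 : ℝ)) n k = 1 := by
  rw [avgI, setIntegral_indicator (measurableSet_dyadicI n k), Set.inter_self, setIntegral_const,
    volume_real_dyadicI, smul_eq_mul, mul_one, ← zpow_add₀ (by norm_num)]
  simp

theorem measurable_haarF (n k : ℤ) : Measurable (haarF n k) :=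
  ((measurable_const.indicator (measurableSet_dyadicI _ _)).sub
    (measurable_const.indicator (measurableSet_dyadicI _ _))).const_mul _

theorem hasCompactSupport_of_abs_eq_indicator {f : ℝ → ℝ} {n k : ℤ} {c : ℝ}
    (h : ∀ x, |f x| = (dyadicI n k).indicator (fun _ => c) x) : HasCompactSupport f := by
  refine HasCompactSupport.intro (isCompact_Icc (a := (n : ℝ) * (2 : ℝ) ^ (-k))
    (b := ((n : ℝ) + 1) * (2 : ℝ) ^ (-k))) fun x hx => ?_
  rw [← abs_eq_zero, h, Set.indicator_of_notMem]
  exact fun h' => hx (Set.Ico_subset_Icc_self h')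

theorem BCS_of_abs_eq_indicator {f : ℝ → ℝ} {n k : ℤ} {c : ℝ} (hf : Measurable f)
    (h : ∀ x, |f x| = (dyadicI n k).indicator (fun _ => c) x) : BCS f := by
  refine ⟨hf, ⟨|c|, fun x => ?_⟩, hasCompactSupport_of_abs_eq_indicator h⟩
  rw [h, Set.indicator_apply]
  split_ifs
  exacts [le_abs_self c, abs_nonneg c]

theorem eLpNorm_of_abs_eq_indicator {f : ℝ → ℝ} {n k : ℤ} {c q : ℝ} (hq : 0 < q)
    (h : ∀ x, |f x| = (dyadicI n k).indicator (fun _ => c) x) :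
    eLpNorm f (ENNReal.ofReal q) volume = ‖c‖ₑ * volume (dyadicI n k) ^ (1 / q) := by
  have hq0 : ENNReal.ofReal q ≠ 0 := by simpa using hq
  rw [← eLpNorm_norm]
  simp only [Real.norm_eq_abs, h]
  rw [eLpNorm_indicator_const (measurableSet_dyadicI n k) hq0 ENNReal.ofReal_ne_top,
    ENNReal.toReal_ofReal hq.le]

/-- The test function of the dyadic interval `(n, k)` for a component `a` of `α⃗`: the Haar
function if `a` is `0`, and the indicator function if `a` is `1`. -/
def testF (n k : ℤ) (a : Bool) : ℝ → ℝ :=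
  if a then (dyadicI n k).indicator fun _ => (1 : ℝ) else haarF n k

theorem abs_testF (n k : ℤ) (a : Bool) (x : ℝ) : |testF n k a x| =
    (dyadicI n k).indicator
      (fun _ => if a = false then (Real.sqrt ((2 : ℝ) ^ (-k)))⁻¹ else 1) x := by
  cases a
  · simp [testF, abs_haarF]
  · by_cases hx : x ∈ dyadicI n k <;> simp [testF, hx]

theorem measurable_testF (n k : ℤ) (a : Bool) : Measurable (testF n k a) := by
  cases a
  · simpa [testF] using measurable_haarF n k
  · simpa [testF] using measurable_const.indicator (measurableSet_dyadicI n k)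

theorem coefI_testF_self (n k : ℤ) (a : Bool) : coefI (testF n k a) a n k = 1 := by
  cases a
  · simpa [testF, coefI] using pairH_haarF_self n k
  · simpa [testF, coefI] using avgI_indicator_self n k

theorem piTerm_testF_self {m : ℕ} (b : ℝ → ℝ) (α : Fin m → Bool) (n k : ℤ) (x : ℝ) :
    piTerm b α (fun j => testF n k (α j)) n k x =
      pairH b n k * haarF n k x ^ (1 + sigmaV α) := by
  simp [piTerm, coefI_testF_self]

theorem piTerm_testF_of_ne {m : ℕ} (b : ℝ → ℝ) {α : Fin m → Bool} (hα : 0 < sigmaV α)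
    {n k n' k' : ℤ} (h : ¬(n' = n ∧ k' = k)) (x : ℝ) :
    piTerm b α (fun j => testF n k (α j)) n' k' x = 0 := by
  obtain ⟨j, hj⟩ := Finset.card_pos.1 hα
  have hj' : α j = false := by simpa using hj
  have : ∏ j, coefI (testF n k (α j)) (α j) n' k' = 0 := by
    refine Finset.prod_eq_zero (Finset.mem_univ j) ?_
    simpa [hj', testF, coefI] using pairH_haarF_of_ne h
  simp [piTerm, this]

theorem HasDyadicSum_of_single {F : ℤ → ℤ → ℝ → ℝ} {n k : ℤ}
    (hF : ∀ n' k' x, ¬(n' = n ∧ k' = k) → F n' k' x = 0) : HasDyadicSum F (F n k) := by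
  refine Eventually.of_forall fun x => tendsto_const_nhds.congr' ?_
  filter_upwards [eventually_ge_atTop k.natAbs] with N hN
  have hk : k ∈ Finset.Icc (-(N : ℤ)) (N : ℤ) := by
    rw [Finset.mem_Icc]
    omega
  rw [dyadicPartialSum, Finset.sum_eq_single_of_mem k hk,
    tsum_eq_single n fun n' hn => hF n' k x fun h => hn h.1]
  intro k' _ hk'
  simp [hF _ k' x fun h => hk' h.2]

theorem prod_rpow_eq_rpow_sum {ι : Type*} (s : Finset ι) (v : ℝ≥0∞) {q : ι → ℝ}
    (hq : ∀ j ∈ s, 0 ≤ q j) : ∏ j ∈ s, v ^ q j = v ^ (∑ j ∈ s, q j) := by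
  induction s using Finset.induction_on with
  | empty => simp
  | insert a s ha ih =>
    have hs : ∀ j ∈ s, 0 ≤ q j := fun j hj => hq j (Finset.mem_insert_of_mem hj)
    rw [Finset.prod_insert ha, Finset.sum_insert ha, ih hs,
      ENNReal.rpow_add_of_nonneg _ _ (hq a (Finset.mem_insert_self a s)) (Finset.sum_nonneg hs)]

theorem prod_eLpNorm_testF {m : ℕ} (α : Fin m → Bool) (p : Fin m → ℝ) (hp : ∀ j, 0 < p j)
    (n k : ℤ) :
    ∏ j, eLpNorm (testF n k (α j)) (ENNReal.ofReal (p j)) volume =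
      ‖(Real.sqrt ((2 : ℝ) ^ (-k)))⁻¹‖ₑ ^ sigmaV α *
        volume (dyadicI n k) ^ (∑ j, 1 / p j) := by
  simp only [eLpNorm_of_abs_eq_indicator (hp _) (abs_testF n k _)]
  rw [Finset.prod_mul_distrib, prod_rpow_eq_rpow_sum _ _ fun j _ => (one_div_pos.2 (hp j)).le]
  congr 1
  simp only [apply_ite (fun c : ℝ => ‖c‖ₑ), Finset.prod_ite, Finset.prod_const, sigmaV]
  simp

/-- For `m ≥ 2`, `σ(α⃗) > 1`, `1 < p_j < ∞` and `1/r = Σ_j 1/p_j`: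
if `‖π_b^{α⃗}(f₁,…,f_m)‖_{L^r} ≤ C ∏_j ‖f_j‖_{L^{p_j}}` for all bounded compactly
supported `f_j`, then `sup_{J∈𝒟} |⟨b,h_J⟩|/√|J| ≤ C`. -/
theorem statement7 (m : ℕ) (hm : 2 ≤ m) (α : Fin m → Bool) (hα : 1 < sigmaV α)
    (p : Fin m → ℝ) (hp : ∀ j, 1 < p j) (r : ℝ) (hr : 1 / r = ∑ j, 1 / p j)
    (b : ℝ → ℝ) (hb : LocallyIntegrable b volume) (C : ℝ)
    (hC : ∀ (f : Fin m → ℝ → ℝ) (g : ℝ → ℝ), (∀ j, BCS (f j)) →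
      HasDyadicSum (piTerm b α f) g →
      eLpNorm' g r volume ≤
        ENNReal.ofReal C * ∏ j, eLpNorm (f j) (ENNReal.ofReal (p j)) volume) :
    starNorm b ≤ ENNReal.ofReal C := by
  have hm0 : 0 < m := by omega
  have hr0 : 0 < r := by
    rw [← one_div_pos, hr]
    exact Finset.sum_pos (fun j _ => one_div_pos.2 (zero_lt_one.trans (hp j)))
      ⟨⟨0, hm0⟩, Finset.mem_univ _⟩
  refine iSup_le fun n => iSup_le fun k => ?_
  set s : ℝ := Real.sqrt ((2 : ℝ) ^ (-k)) with hs
  have hs0 : 0 < s := Real.sqrt_pos.2 (by positivity)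
  have habs : ∀ x, |piTerm b α (fun j => testF n k (α j)) n k x| =
      (dyadicI n k).indicator (fun _ => |pairH b n k| * s⁻¹ ^ (1 + sigmaV α)) x := by
    intro x
    rw [piTerm_testF_self, abs_mul, abs_pow, abs_haarF]
    by_cases hx : x ∈ dyadicI n k <;> simp [hx, hs]
  have key := hC (fun j => testF n k (α j)) _
    (fun j => BCS_of_abs_eq_indicator (measurable_testF n k _) (abs_testF n k _))
    (HasDyadicSum_of_single fun n' k' x h => piTerm_testF_of_ne b (by omega) h x)
  have hlhs := eLpNorm_of_abs_eq_indicator hr0 habs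
  rw [eLpNorm_eq_eLpNorm' (by simpa using hr0) ENNReal.ofReal_ne_top,
    ENNReal.toReal_ofReal hr0.le] at hlhs
  rw [hlhs, prod_eLpNorm_testF α p (fun j => zero_lt_one.trans (hp j)), ← hr, ← hs, pow_add,
    pow_one, ← mul_assoc, enorm_mul, enorm_pow, mul_assoc] at key
  have hD0 : ‖s⁻¹‖ₑ ^ sigmaV α * volume (dyadicI n k) ^ (1 / r) ≠ 0 :=
    mul_ne_zero (pow_ne_zero _ (by simpa using hs0.ne'))
      (ENNReal.rpow_pos (volume_dyadicI_pos n k) (volume_dyadicI_ne_top n k)).ne'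
  have hDt : ‖s⁻¹‖ₑ ^ sigmaV α * volume (dyadicI n k) ^ (1 / r) ≠ ⊤ :=
    ENNReal.mul_ne_top (ENNReal.pow_ne_top enorm_ne_top)
      (ENNReal.rpow_ne_top_of_nonneg (by positivity) (volume_dyadicI_ne_top n k))
  rw [ENNReal.mul_le_mul_iff_left hD0 hDt, Real.enorm_of_nonneg (by positivity)] at key
  rwa [div_eq_mul_inv]

end
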